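/- Let n ≥ 1 and let B be any orthonormal basis of the real inner product space sp(n). Then Σ_{Q∈B} Q² = −((2n+1)/2)·I_{2n}. (Consequently, for every q ∈ Sp(n) the coordinate functions satisfy τ(q_{jα}) = Σ_{Q∈B} (q·Q²)_{jα} = −((2n+1)/2)·q_{jα}, i.e. they are eigenfunctions of the Laplace–Beltrami operator on Sp(n) with eigenvalue −(2n+1)/2.) -/

import Mathlib

open Matrix

/-- The standard complex structure matrix `J_n = [[0, I_n], [-I_n, 0]]` of size `2n × 2n`. -/
def Jmat (n : ℕ) : Matrix (Fin (2 * n)) (Fin (2 * n)) ℂ :=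
  Matrix.of fun i j =>
    if (i : ℕ) + n = (j : ℕ) then 1 else if (j : ℕ) + n = (i : ℕ) then -1 else 0

section SymplecticCasimir

variable {ι : Type*} [Fintype ι]

/-- The orthogonal projection of a complex matrix to the skew-Hermitian matrices `Q` with
`Q J + J Qᵀ = 0`. -/
noncomputable def symplecticProj (J M : Matrix ι ι ℂ) : Matrix ι ι ℂ :=
  (1 / 4 : ℝ) • ((M - Mᴴ) + J * (M - Mᴴ)ᵀ * J)

lemma symplecticProj_conjTranspose {J : Matrix ι ι ℂ} (hJH : Jᴴ = -J) (M : Matrix ι ι ℂ) :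
    (symplecticProj J M)ᴴ = -symplecticProj J M := by
  have h : (M - Mᴴ)ᵀᴴ = -(M - Mᴴ)ᵀ := by
    ext i j
    simp
  have h' : (M - Mᴴ)ᴴ = -(M - Mᴴ) := by simp
  simp only [symplecticProj, conjTranspose_smul, conjTranspose_add, conjTranspose_mul, h, h', hJH,
    star_trivial, ← smul_neg]
  congr 1
  noncomm_ring

variable [DecidableEq ι]

lemma symplecticProj_symplectic {J : Matrix ι ι ℂ} (hJJ : J * J = -1) (hJT : Jᵀ = -J)
    (M : Matrix ι ι ℂ) :
    symplecticProj J M * J + J * (symplecticProj J M)ᵀ = 0 := by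
  simp only [symplecticProj, transpose_smul, smul_mul_assoc, mul_smul_comm, ← smul_add]
  generalize M - Mᴴ = A
  have h₁ : J * Aᵀ * J * J = -(J * Aᵀ) := by rw [mul_assoc, hJJ]; simp
  have h₂ : J * (J * (A * J)) = -(A * J) := by rw [← mul_assoc, hJJ]; simp
  simp only [transpose_add, transpose_mul, transpose_transpose, hJT, add_mul, mul_add, h₁,
    neg_mul, mul_neg, neg_neg, h₂]
  simp

lemma re_trace_symplecticProj_mul {J : Matrix ι ι ℂ} (hJJ : J * J = -1)
    {Q : Matrix ι ι ℂ} (hQ : Qᴴ = -Q) (hQJ : Q * J + J * Qᵀ = 0) (M : Matrix ι ι ℂ) :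
    (trace (symplecticProj J M * Qᴴ)).re = (trace (M * Qᴴ)).re := by
  have hJQJ : J * Q * J = Qᵀ := by
    rw [mul_assoc, eq_neg_of_add_eq_zero_left hQJ, mul_neg, ← mul_assoc, hJJ]
    simp
  have h₁ (A : Matrix ι ι ℂ) : trace (J * Aᵀ * J * Q) = trace (A * Q) := by
    rw [mul_assoc, mul_assoc, trace_mul_comm, mul_assoc, trace_mul_comm, hJQJ, ← transpose_mul,
      trace_transpose]
  have h₂ : (trace (Mᴴ * Q)).re = -(trace (M * Q)).re := by
    have h : trace (Mᴴ * Q) = star (trace (Qᴴ * M)) := by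
      rw [← trace_conjTranspose, conjTranspose_mul, conjTranspose_conjTranspose]
    rw [h, hQ, neg_mul, trace_neg, trace_mul_comm Q]
    simp
  simp only [symplecticProj, hQ, mul_neg, trace_neg, smul_mul_assoc, trace_smul, add_mul,
    trace_add, h₁, sub_mul, trace_sub, Complex.neg_re, Complex.smul_re, Complex.add_re,
    Complex.sub_re, h₂, smul_eq_mul]
  ring

lemma symplecticProj_single_add_I_smul (J : Matrix ι ι ℂ) (a b : ι) :
    symplecticProj J (single a b 1) + Complex.I • symplecticProj J (single a b Complex.I) =
      (-1 / 2 : ℂ) • (single b a 1 + J * single a b 1 * J) := by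
  have hI (c d : ι) : single c d Complex.I = Complex.I • single c d (1 : ℂ) := by simp
  have hI' (c d : ι) : single c d (-Complex.I) = -Complex.I • single c d (1 : ℂ) := by
    rw [smul_single, smul_eq_mul, mul_one]
  have hr (X : Matrix ι ι ℂ) : (1 / 4 : ℝ) • X = (1 / 4 : ℂ) • X := by
    ext i j
    simp [Complex.real_smul]
  simp only [symplecticProj, hr, conjTranspose_single, transpose_sub, transpose_single, star_one,
    Complex.star_def, Complex.conj_I]
  simp only [hI, hI', mul_sub, sub_mul, mul_smul_comm, smul_mul_assoc]
  match_scalars <;> ring_nf <;> simp <;> norm_num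

/-- Expansion of a vector of the span of an orthonormal finite set of matrices, for the real inner
product `Re tr (Z Wᴴ)`. -/
lemma sum_re_trace_smul_eq_of_mem_span (B : Finset (Matrix ι ι ℂ))
    (honb : ∀ Q ∈ B, ∀ Q' ∈ B, (Matrix.trace (Q * Q'ᴴ)).re = if Q = Q' then 1 else 0)
    {X : Matrix ι ι ℂ} (hX : X ∈ Submodule.span ℝ (B : Set (Matrix ι ι ℂ))) :
    ∑ Q ∈ B, (Matrix.trace (X * Qᴴ)).re • Q = X := by
  induction hX using Submodule.span_induction with
  | mem x hx =>
    rw [Finset.sum_congr rfl fun Q hQ => by rw [honb x hx Q hQ]]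
    simp only [ite_smul, one_smul, zero_smul, Finset.sum_ite_eq]
    exact if_pos hx
  | zero => simp
  | add x y _ _ hx hy =>
    simp only [add_mul, trace_add, Complex.add_re, add_smul, Finset.sum_add_distrib, hx, hy]
  | smul a x _ hx =>
    simp only [smul_mul_assoc, trace_smul, Complex.smul_re, smul_assoc, ← Finset.smul_sum, hx]

/-- Sum of the squares of an orthonormal basis of the skew-Hermitian matrices `Q` with
`Q J + J Qᵀ = 0`, for `J` a real orthogonal complex structure. -/
lemma sum_mul_self_of_orthonormal_symplectic {J : Matrix ι ι ℂ} (hJJ : J * J = -1)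
    (hJT : Jᵀ = -J) (hJH : Jᴴ = -J) (B : Finset (Matrix ι ι ℂ))
    (hskew : ∀ Q ∈ B, Qᴴ = -Q) (hsymp : ∀ Q ∈ B, Q * J + J * Qᵀ = 0)
    (honb : ∀ Q ∈ B, ∀ Q' ∈ B, (trace (Q * Q'ᴴ)).re = if Q = Q' then 1 else 0)
    (hspan : ∀ X : Matrix ι ι ℂ, Xᴴ = -X → X * J + J * Xᵀ = 0 →
      X ∈ Submodule.span ℝ (B : Set (Matrix ι ι ℂ))) :
    ∑ Q ∈ B, Q * Q = -(((Fintype.card ι : ℂ) + 1) / 2) • (1 : Matrix ι ι ℂ) := by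
  have hproj (M : Matrix ι ι ℂ) :
      ∑ Q ∈ B, (trace (M * Qᴴ)).re • Q = symplecticProj J M := by
    rw [← sum_re_trace_smul_eq_of_mem_span B honb
      (hspan _ (symplecticProj_conjTranspose hJH M) (symplecticProj_symplectic hJJ hJT M))]
    exact Finset.sum_congr rfl fun Q hQ => by
      rw [re_trace_symplecticProj_mul hJJ (hskew Q hQ) (hsymp Q hQ)]
  have hentry (a b : ι) :
      ∑ Q ∈ B, Q a b • Q = (-1 / 2 : ℂ) • (single b a 1 + J * single a b 1 * J) := by
    rw [← symplecticProj_single_add_I_smul, ← hproj, ← hproj, Finset.smul_sum,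
      ← Finset.sum_add_distrib]
    refine Finset.sum_congr rfl fun Q _ => ?_
    ext i j
    simp only [trace_single_mul, conjTranspose_apply, Matrix.add_apply, Matrix.smul_apply, smul_eq_mul]
    apply Complex.ext <;> simp [sub_eq_add_neg]
  have hJ (i j : ι) : ∑ k, J k i * J k j = (1 : Matrix ι ι ℂ) i j := by
    have h : Jᵀ * J = 1 := by rw [hJT, neg_mul, hJJ, neg_neg]
    simpa [Matrix.mul_apply] using congrFun (congrFun h i) j
  ext i j
  have hsum : (∑ Q ∈ B, Q * Q) i j = ∑ k, (∑ Q ∈ B, Q i k • Q) k j := by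
    simp only [Matrix.sum_apply, Matrix.mul_apply, Matrix.smul_apply, smul_eq_mul]
    exact Finset.sum_comm
  have hterm (k : ι) : (single k i 1 + J * single i k 1 * J : Matrix ι ι ℂ) k j =
      (1 : Matrix ι ι ℂ) i j + J k i * J k j := by
    simp [Matrix.mul_apply, single_apply, Matrix.one_apply, ite_and]
  simp only [hsum, hentry, hterm, ← Finset.mul_sum, Finset.sum_add_distrib, hJ, Finset.sum_const,
    Finset.card_univ, nsmul_eq_mul, Matrix.smul_apply, smul_eq_mul]
  ring

end SymplecticCasimir

lemma Jmat_transpose (n : ℕ) : (Jmat n)ᵀ = -Jmat n := by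
  ext i j
  simp only [Jmat, transpose_apply, of_apply, Matrix.neg_apply]
  split_ifs <;> first | omega | simp

lemma Jmat_conjTranspose (n : ℕ) : (Jmat n)ᴴ = -Jmat n := by
  rw [← Jmat_transpose]
  ext i j
  simp only [Jmat, transpose_apply, conjTranspose_apply, of_apply]
  split_ifs <;> simp

lemma Jmat_mul_self (n : ℕ) : Jmat n * Jmat n = -1 := by
  ext i j
  have hi := i.isLt
  have hj := j.isLt
  rw [Matrix.mul_apply]
  let c : Fin (2 * n) := if h : (i : ℕ) < n then ⟨i + n, by omega⟩ else ⟨i - n, by omega⟩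
  have hc : (c : ℕ) = if (i : ℕ) < n then i + n else i - n := by
    simp only [c]
    split_ifs <;> rfl
  rw [Finset.sum_eq_single c]
  · simp only [Jmat, of_apply, Matrix.neg_apply, Matrix.one_apply, hc, Fin.ext_iff]
    split_ifs <;> first | omega | simp
  · intro k _ hk
    have hk' : (k : ℕ) ≠ c := fun h => hk (Fin.ext h)
    rw [hc] at hk'
    have h0 : Jmat n i k = 0 := by
      simp only [Jmat, of_apply]
      split_ifs at hk' ⊢ <;> first | omega | rfl
    rw [h0, zero_mul]
  · simp

/-- **Casimir/Laplacian constant for Sp(n).**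
For any orthonormal basis `B` of `sp(n)` (the skew-Hermitian `2n × 2n` matrices `Q` with
`Q J_n + J_n Qᵗ = 0`, inner product `⟨Z,W⟩ = Re tr(Z W*)`),
`∑_{Q ∈ B} Q² = -((2n+1)/2) I_{2n}`; hence the coordinate functions on `Sp(n)` are
eigenfunctions of the Laplace–Beltrami operator with eigenvalue `-(2n+1)/2`. -/
theorem stmt_10 (n : ℕ) (hn : 1 ≤ n)
    (B : Finset (Matrix (Fin (2 * n)) (Fin (2 * n)) ℂ))
    (hskew : ∀ Q ∈ B, Qᴴ = -Q)
    (hsymp : ∀ Q ∈ B, Q * Jmat n + Jmat n * Qᵀ = 0)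
    (honb : ∀ Q ∈ B, ∀ Q' ∈ B,
      (Matrix.trace (Q * Q'ᴴ)).re = if Q = Q' then 1 else 0)
    (hspan : ∀ X : Matrix (Fin (2 * n)) (Fin (2 * n)) ℂ,
      Xᴴ = -X → X * Jmat n + Jmat n * Xᵀ = 0 →
      X ∈ Submodule.span ℝ (B : Set (Matrix (Fin (2 * n)) (Fin (2 * n)) ℂ))) :
    ∑ Q ∈ B, Q * Q = -(((2 * (n : ℂ) + 1) / 2)) • (1 : Matrix (Fin (2 * n)) (Fin (2 * n)) ℂ) := by
  simpa using sum_mul_self_of_orthonormal_symplectic (Jmat_mul_self n) (Jmat_transpose n)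
    (Jmat_conjTranspose n) B hskew hsymp honb hspan
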